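/- Let L ⊆ Ã* be a language of reduced words with μ(L) = G, let ν : ℕ → ℕ be non-decreasing, and suppose (G, L) satisfies Property BP_ν. Let H ≤ G be L-quasi-convex with constant k. Then H is almost malnormal (i.e. H ∩ H^g is finite for every g ∉ H) if and only if H ∩ H^x is finite for every x ∉ H with |x| ≤ 2ν(k). -/

import Mathlib

open List

/-- A word over the alphabet Ã = A ∪ A⁻¹ is a `List (A × Bool)`: the letter `(a, true)`
stands for `a` and `(a, false)` for the formal inverse `a⁻¹`. A word is *reduced* if it
has no factor `a·a⁻¹` or `a⁻¹·a`. -/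
def Reduced {A : Type*} (w : List (A × Bool)) : Prop :=
  w.Chain' fun p q => ¬(p.1 = q.1 ∧ q.2 = !p.2)

variable {A : Type*} [Fintype A] {G : Type*} [Group G]

/-- Evaluation in `G` of a word over Ã, determined by the images `f a` of the letters.
This is the (inverse-respecting) monoid homomorphism μ : Ã* → G. -/
def eval (f : A → G) (w : List (A × Bool)) : G :=
  (w.map fun p => if p.2 then f p.1 else (f p.1)⁻¹).prod

/-- Word length of `g ∈ G` with respect to the generators `A`:
the least length of a word over Ã mapping onto `g`. -/
noncomputable def wlen (f : A → G) (g : G) : ℕ :=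
  sInf {n | ∃ w : List (A × Bool), eval f w = g ∧ w.length = n}

/-- A rational structure: `L` is a regular language of reduced words with μ(L) = G. -/
def RationalStructure (f : A → G) (L : Set (List (A × Bool))) : Prop :=
  Language.IsRegular (L : Language (A × Bool)) ∧ (∀ w ∈ L, Reduced w) ∧
    ∀ g : G, ∃ w ∈ L, eval f w = g

/-- `H` is L-quasi-convex with constant `k`: for every `w ∈ L` with `μ(w) ∈ H` and
every prefix `u` of `w`, there is `h ∈ H` with `|h⁻¹ μ(u)| ≤ k`. -/
def QCW (f : A → G) (L : Set (List (A × Bool))) (H : Subgroup G) (k : ℕ) : Prop :=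
  ∀ w ∈ L, eval f w ∈ H → ∀ u, u <+: w → ∃ h ∈ H, wlen f (h⁻¹ * eval f u) ≤ k

/-- The set of right cosets `H·μ(u)` where `u` ranges over prefixes of words
`w ∈ L` with `μ(w) ∈ H` (the vertex set of the Stallings graph Γ_L(H)). -/
def VL (f : A → G) (L : Set (List (A × Bool))) (H : Subgroup G) : Set (Set G) :=
  {S | ∃ w ∈ L, eval f w ∈ H ∧ ∃ u, u <+: w ∧ S = {x | ∃ h ∈ H, x = h * eval f u}}

/-- The left coset g·H as a subset of G. -/
def lcoset (g : G) (H : Subgroup G) : Set G := {x | ∃ h ∈ H, x = g * h}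

/-- The right coset H·g as a subset of G. -/
def rcoset (H : Subgroup G) (g : G) : Set G := {x | ∃ h ∈ H, x = h * g}

/-- The conjugate subgroup H^g = g⁻¹Hg. -/
def conjG {G : Type*} [Group G] (H : Subgroup G) (g : G) : Subgroup G :=
  Subgroup.map ((MulAut.conj g⁻¹).toMonoidHom) H

/-- The double coset H·g·K as a subset of G. -/
def dcoset (H : Subgroup G) (g : G) (K : Subgroup G) : Set G :=
  {x | ∃ h ∈ H, ∃ k ∈ K, x = h * g * k}

/-- Property BP_ν: whenever H, K are L-quasi-convex subgroups with common constant k,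
and K, g₁H, …, g_nH are pairwise distinct subsets of G such that
K ∩ g₁Hg₁⁻¹ ∩ … ∩ g_nHg_n⁻¹ is infinite, there exists z ∈ G such that the ball of
center z and radius ν(k) (in the word metric) meets K and each coset g_iH. -/
def BP (f : A → G) (L : Set (List (A × Bool))) (ν : ℕ → ℕ) : Prop :=
  ∀ (H K : Subgroup G) (k : ℕ), QCW f L H k → QCW f L K k →
    ∀ n : ℕ, 1 ≤ n → ∀ g : Fin n → G,
      Function.Injective
        (Fin.cons (K : Set G) (fun i => lcoset (g i) H) : Fin (n + 1) → Set G) →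
      (((K ⊓ ⨅ i, conjG H (g i)⁻¹ : Subgroup G) : Set G)).Infinite →
      ∃ z : G, (∃ w ∈ K, wlen f (z⁻¹ * w) ≤ ν k) ∧
        ∀ i, ∃ w ∈ lcoset (g i) H, wlen f (z⁻¹ * w) ≤ ν k

theorem wlen_spec (f : A → G) (L : Set (List (A × Bool)))
    (hsurj : ∀ g : G, ∃ w ∈ L, eval f w = g) (g : G) :
    ∃ w : List (A × Bool), eval f w = g ∧ w.length = wlen f g := by
  obtain ⟨w, -, hw⟩ := hsurj g
  exact Nat.sInf_mem (s := {n | ∃ w : List (A × Bool), eval f w = g ∧ w.length = n})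
    ⟨w.length, w, hw, rfl⟩

theorem wlen_le (f : A → G) (w : List (A × Bool)) : wlen f (eval f w) ≤ w.length :=
  Nat.sInf_le ⟨w, rfl, rfl⟩

theorem eval_inv (f : A → G) (w : List (A × Bool)) :
    ∃ w' : List (A × Bool), eval f w' = (eval f w)⁻¹ ∧ w'.length = w.length := by
  induction w with
  | nil => exact ⟨[], by simp [eval], rfl⟩
  | cons p t ih =>
    obtain ⟨t', h1, h2⟩ := ih
    refine ⟨t' ++ [(p.1, !p.2)], ?_, by simp [h2]⟩
    have h3 : eval f (t' ++ [(p.1, !p.2)]) = eval f t' * eval f [(p.1, !p.2)] := by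
      simp [eval]
    have h4 : eval f (p :: t) = eval f [p] * eval f t := by
      simp [eval]
    rw [h3, h4, h1, mul_inv_rev]
    congr 1
    rcases p with ⟨a, _ | _⟩ <;> simp [eval]

theorem wlen_inv_mul_le (f : A → G) (L : Set (List (A × Bool)))
    (hsurj : ∀ g : G, ∃ w ∈ L, eval f w = g) (a b : G) :
    wlen f (a⁻¹ * b) ≤ wlen f a + wlen f b := by
  obtain ⟨u, hu, hu'⟩ := wlen_spec f L hsurj a
  obtain ⟨v, hv, hv'⟩ := wlen_spec f L hsurj b
  obtain ⟨u', h1, h2⟩ := eval_inv f u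
  have h := wlen_le f (u' ++ v)
  have h3 : eval f (u' ++ v) = a⁻¹ * b := by
    rw [← hu, ← hv, ← h1]; simp [eval]
  rw [h3] at h
  simpa [h2, hu', hv'] using h

theorem mem_conjG (H : Subgroup G) (g x : G) : x ∈ conjG H g ↔ g * x * g⁻¹ ∈ H := by
  unfold conjG
  constructor
  · rintro ⟨h, hh, rfl⟩
    simpa [mul_assoc] using hh
  · intro h
    exact ⟨_, h, by simp [mul_assoc]⟩

/-- under Property BP_ν, an L-quasi-convex subgroup H with constant k is
almost malnormal (H ∩ H^g finite for all g ∉ H) iff H ∩ H^x is finite for every x ∉ H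
with |x| ≤ 2ν(k). -/
theorem stmt14 (f : A → G) (L : Set (List (A × Bool)))
    (hred : ∀ w ∈ L, Reduced w) (hsurj : ∀ g : G, ∃ w ∈ L, eval f w = g)
    (ν : ℕ → ℕ) (hν : Monotone ν) (hBP : BP f L ν)
    (H : Subgroup G) (k : ℕ) (hH : QCW f L H k) :
    (∀ g : G, g ∉ H → (((H ⊓ conjG H g : Subgroup G) : Set G)).Finite) ↔
    (∀ x : G, x ∉ H → wlen f x ≤ 2 * ν k →
      (((H ⊓ conjG H x : Subgroup G) : Set G)).Finite) := by
  constructor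
  · intro h x hx _
    exact h x hx
  · intro h g hg
    by_contra hinf
    have hlc : ∀ x, x ∈ lcoset g⁻¹ H ↔ g * x ∈ H := by
      intro x
      constructor
      · rintro ⟨y, hy, rfl⟩
        simpa using hy
      · intro hx
        exact ⟨_, hx, by simp⟩
    have hne : (H : Set G) ≠ lcoset g⁻¹ H := by
      intro he
      have h1 : (1 : G) ∈ lcoset g⁻¹ H := he ▸ H.one_mem
      rw [hlc] at h1
      exact hg (by simpa using h1)
    obtain ⟨z, ⟨w, hw, hzw⟩, hz⟩ := hBP H H k hH hH 1 le_rfl (fun _ => g⁻¹)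
      (by
        rw [Fin.cons_injective_iff]
        refine ⟨?_, fun i j _ => Subsingleton.elim i j⟩
        rintro ⟨i, hi⟩
        exact hne hi.symm)
      (by
        have : (⨅ _i : Fin 1, conjG H (g⁻¹)⁻¹) = conjG H g := by
          rw [inv_inv]; exact ciInf_const
        rw [this]; exact hinf)
    obtain ⟨w', hw', hzw'⟩ := hz 0
    rw [hlc] at hw'
    have hlen : wlen f (w'⁻¹ * w) ≤ 2 * ν k := by
      have := wlen_inv_mul_le f L hsurj (z⁻¹ * w') (z⁻¹ * w)
      have e : (z⁻¹ * w')⁻¹ * (z⁻¹ * w) = w'⁻¹ * w := by group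
      rw [e] at this
      omega
    have hx : w'⁻¹ * w ∉ H := by
      intro hc
      apply hg
      have := H.mul_mem (H.mul_mem hw' hc) (H.inv_mem hw)
      have e : g * w' * (w'⁻¹ * w) * w⁻¹ = g := by group
      rwa [e] at this
    have hfin := h _ hx hlen
    apply hinf
    apply (hfin.image (fun y => w * y * w⁻¹)).subset
    rintro y ⟨hy1, hy2⟩
    refine ⟨w⁻¹ * y * w, ⟨?_, ?_⟩, by group⟩
    · exact H.mul_mem (H.mul_mem (H.inv_mem hw) hy1) hw
    · have hy3 := (mem_conjG H g y).1 hy2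
      refine (mem_conjG H _ _).2 ?_
      have := H.mul_mem (H.mul_mem (H.inv_mem hw') hy3) hw'
      have e : (g * w')⁻¹ * (g * y * g⁻¹) * (g * w')
          = w'⁻¹ * w * (w⁻¹ * y * w) * (w'⁻¹ * w)⁻¹ := by group
      rwa [e] at this
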